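/- For every fixed m ∈ Fin 7, the 5-form Σ_p (e_p ⌟ ψ) ∧ (e_p ⌟ (e_m ⌟ ψ)) equals 4 e_m♭ ∧ ψ (which in the paper's convention equals 4 ⋆(e_m ⌟ φ)); explicitly, for all i₁, i₂, i₃, i₄, i₅ ∈ Fin 7 its (i₁,…,i₅) component equals 4 Σ_{a=1}^{5} (−1)^{a−1} δ_{m i_a} ψ_{i₁…î_a…i₅}, where î_a means the index i_a is omitted. -/

import Mathlib

open Finset

/-- Kronecker delta on `Fin 7`. -/
def kd (i j : Fin 7) : ℝ := if i = j then 1 else 0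

/-- Components of the basic 3-form `e^a ∧ e^b ∧ e^c` (a 3×3 determinant of deltas). -/
def E3 (a b c i j k : Fin 7) : ℝ :=
  kd a i * kd b j * kd c k + kd a j * kd b k * kd c i + kd a k * kd b i * kd c j
    - kd a i * kd b k * kd c j - kd a j * kd b i * kd c k - kd a k * kd b j * kd c i

/-- The standard G₂ 3-form `φ` on `ℝ⁷`, determined by
`φ_{123} = φ_{145} = φ_{167} = φ_{246} = 1`, `φ_{257} = φ_{347} = φ_{356} = −1`
(indices `1,…,7` correspond to `0,…,6 : Fin 7`). -/
def g2phi (i j k : Fin 7) : ℝ :=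
  E3 0 1 2 i j k + E3 0 3 4 i j k + E3 0 5 6 i j k + E3 1 3 5 i j k
    - E3 1 4 6 i j k - E3 2 3 6 i j k - E3 2 4 5 i j k

/-- Components of the basic 4-form `e^a ∧ e^b ∧ e^c ∧ e^d` (a 4×4 determinant of deltas). -/
def E4 (a b c d i j k l : Fin 7) : ℝ :=
  kd a i * E3 b c d j k l - kd a j * E3 b c d i k l
    + kd a k * E3 b c d i j l - kd a l * E3 b c d i j k

/-- The dual 4-form `ψ = ⋆φ` on `ℝ⁷`, determined by
`ψ_{1247} = ψ_{1256} = ψ_{1346} = 1`, `ψ_{1357} = ψ_{2345} = ψ_{2367} = ψ_{4567} = −1`. -/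
def g2psi (i j k l : Fin 7) : ℝ :=
  E4 0 1 3 6 i j k l + E4 0 1 4 5 i j k l + E4 0 2 3 5 i j k l
    - E4 0 2 4 6 i j k l - E4 1 2 3 4 i j k l - E4 1 2 5 6 i j k l - E4 3 4 5 6 i j k l

/-- Wedge product of two 2-forms on `ℝ⁷`, in components:
`(α ∧ β)_{i₁…i₄} = (1/(2!·2!)) Σ_{σ ∈ S₄} sgn(σ) α_{i_{σ(1)} i_{σ(2)}} β_{i_{σ(3)} i_{σ(4)}}`. -/
noncomputable def wedge22 (α β : Fin 7 → Fin 7 → ℝ) (i j k l : Fin 7) : ℝ :=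
  (1 : ℝ) / ((Nat.factorial 2 : ℝ) * (Nat.factorial 2 : ℝ)) *
    ∑ σ : Equiv.Perm (Fin 4),
      ((Equiv.Perm.sign σ : ℤ) : ℝ) *
        (α (![i, j, k, l] (σ 0)) (![i, j, k, l] (σ 1)) *
          β (![i, j, k, l] (σ 2)) (![i, j, k, l] (σ 3)))

/-- Wedge product of a 2-form and a 1-form on `ℝ⁷`, in components. -/
noncomputable def wedge21 (α : Fin 7 → Fin 7 → ℝ) (β : Fin 7 → ℝ) (i j k : Fin 7) : ℝ :=
  (1 : ℝ) / ((Nat.factorial 2 : ℝ) * (Nat.factorial 1 : ℝ)) *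
    ∑ σ : Equiv.Perm (Fin 3),
      ((Equiv.Perm.sign σ : ℤ) : ℝ) *
        (α (![i, j, k] (σ 0)) (![i, j, k] (σ 1)) * β (![i, j, k] (σ 2)))

/-- Wedge product of a 2-form and a 3-form on `ℝ⁷`, in components. -/
noncomputable def wedge23 (α : Fin 7 → Fin 7 → ℝ) (β : Fin 7 → Fin 7 → Fin 7 → ℝ)
    (i1 i2 i3 i4 i5 : Fin 7) : ℝ :=
  (1 : ℝ) / ((Nat.factorial 2 : ℝ) * (Nat.factorial 3 : ℝ)) *
    ∑ σ : Equiv.Perm (Fin 5),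
      ((Equiv.Perm.sign σ : ℤ) : ℝ) *
        (α (![i1, i2, i3, i4, i5] (σ 0)) (![i1, i2, i3, i4, i5] (σ 1)) *
          β (![i1, i2, i3, i4, i5] (σ 2)) (![i1, i2, i3, i4, i5] (σ 3))
            (![i1, i2, i3, i4, i5] (σ 4)))

/-- Wedge product of a 3-form and a 1-form on `ℝ⁷`, in components. -/
noncomputable def wedge31 (α : Fin 7 → Fin 7 → Fin 7 → ℝ) (β : Fin 7 → ℝ)
    (i j k l : Fin 7) : ℝ :=
  (1 : ℝ) / ((Nat.factorial 3 : ℝ) * (Nat.factorial 1 : ℝ)) *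
    ∑ σ : Equiv.Perm (Fin 4),
      ((Equiv.Perm.sign σ : ℤ) : ℝ) *
        (α (![i, j, k, l] (σ 0)) (![i, j, k, l] (σ 1)) (![i, j, k, l] (σ 2)) *
          β (![i, j, k, l] (σ 3)))

/-- Wedge product of a 3-form and a 2-form on `ℝ⁷`, in components. -/
noncomputable def wedge32 (α : Fin 7 → Fin 7 → Fin 7 → ℝ) (β : Fin 7 → Fin 7 → ℝ)
    (i1 i2 i3 i4 i5 : Fin 7) : ℝ :=
  (1 : ℝ) / ((Nat.factorial 3 : ℝ) * (Nat.factorial 2 : ℝ)) *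
    ∑ σ : Equiv.Perm (Fin 5),
      ((Equiv.Perm.sign σ : ℤ) : ℝ) *
        (α (![i1, i2, i3, i4, i5] (σ 0)) (![i1, i2, i3, i4, i5] (σ 1))
            (![i1, i2, i3, i4, i5] (σ 2)) *
          β (![i1, i2, i3, i4, i5] (σ 3)) (![i1, i2, i3, i4, i5] (σ 4)))

/-- Wedge product of two 3-forms on `ℝ⁷`, in components. -/
noncomputable def wedge33 (α β : Fin 7 → Fin 7 → Fin 7 → ℝ)
    (i1 i2 i3 i4 i5 i6 : Fin 7) : ℝ :=
  (1 : ℝ) / ((Nat.factorial 3 : ℝ) * (Nat.factorial 3 : ℝ)) *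
    ∑ σ : Equiv.Perm (Fin 6),
      ((Equiv.Perm.sign σ : ℤ) : ℝ) *
        (α (![i1, i2, i3, i4, i5, i6] (σ 0)) (![i1, i2, i3, i4, i5, i6] (σ 1))
            (![i1, i2, i3, i4, i5, i6] (σ 2)) *
          β (![i1, i2, i3, i4, i5, i6] (σ 3)) (![i1, i2, i3, i4, i5, i6] (σ 4))
            (![i1, i2, i3, i4, i5, i6] (σ 5)))

/-- `(ℓ_φ h)_{ijk} = Σ_m (h_{im} φ_{mjk} + h_{jm} φ_{imk} + h_{km} φ_{ijm})`. -/
noncomputable def ellphi (h : Fin 7 → Fin 7 → ℝ) (i j k : Fin 7) : ℝ :=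
  ∑ m : Fin 7, (h i m * g2phi m j k + h j m * g2phi i m k + h k m * g2phi i j m)

/-- `(ℓ_ψ h)_{ijkl} = Σ_m (h_{im} ψ_{mjkl} + h_{jm} ψ_{imkl} + h_{km} ψ_{ijml} + h_{lm} ψ_{ijkm})`. -/
noncomputable def ellpsi (h : Fin 7 → Fin 7 → ℝ) (i j k l : Fin 7) : ℝ :=
  ∑ m : Fin 7,
    (h i m * g2psi m j k l + h j m * g2psi i m k l + h k m * g2psi i j m l + h l m * g2psi i j k m)

/-- A function of tuples that changes sign under each adjacent transposition of its arguments. -/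
def IsAlternatingArray {n : ℕ} {ι : Type*} (f : (Fin (n + 1) → ι) → ℝ) : Prop :=
  ∀ (v : Fin (n + 1) → ι) (i : Fin n), f (v ∘ Equiv.swap i.castSucc i.succ) = -f v

namespace IsAlternatingArray

variable {n : ℕ} {ι : Type*} {f g : (Fin (n + 1) → ι) → ℝ}

theorem comp_perm (hf : IsAlternatingArray f) (v : Fin (n + 1) → ι)
    (σ : Equiv.Perm (Fin (n + 1))) :
    f (v ∘ σ) = ((Equiv.Perm.sign σ : ℤ) : ℝ) * f v := by
  have hσ : σ ∈ Submonoid.closure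
      (Set.range fun i : Fin n ↦ Equiv.swap i.castSucc i.succ) := by
    rw [Equiv.Perm.mclosure_swap_castSucc_succ]
    exact Submonoid.mem_top σ
  induction hσ using Submonoid.closure_induction_right with
  | one => simp
  | mul_right σ _ τ hτ ih =>
    obtain ⟨i, rfl⟩ := hτ
    rw [Equiv.Perm.coe_mul, ← Function.comp_assoc, hf, ih, map_mul,
      Equiv.Perm.sign_swap (Fin.castSucc_lt_succ (i := i)).ne]
    simp

theorem eq_zero_of_not_injective (hf : IsAlternatingArray f) {v : Fin (n + 1) → ι}
    (hv : ¬ Function.Injective v) : f v = 0 := by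
  obtain ⟨i, j, hij, hne⟩ : ∃ i j, v i = v j ∧ i ≠ j := by
    simpa [Function.Injective] using hv
  have h := hf.comp_perm v (Equiv.swap i j)
  have hcomp : v ∘ Equiv.swap i j = v := by
    funext k
    simp only [Function.comp_apply, Equiv.swap_apply_def]
    split_ifs with h1 h2
    · rw [h1, hij]
    · rw [h2, hij]
    · rfl
  rw [hcomp, Equiv.Perm.sign_swap hne] at h
  simp only [Units.val_neg, Units.val_one, Int.cast_neg, Int.cast_one] at h
  linarith

/-- Alternating arrays are determined by their values on increasing tuples. -/
theorem ext_strictMono [LinearOrder ι] (hf : IsAlternatingArray f) (hg : IsAlternatingArray g)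
    (h : ∀ v, StrictMono v → f v = g v) : f = g := by
  funext v
  by_cases hv : Function.Injective v
  · have hs : StrictMono (v ∘ Tuple.sort v) :=
      (Tuple.monotone_sort v).strictMono_of_injective (hv.comp (Tuple.sort v).injective)
    have hfg := h _ hs
    rw [hf.comp_perm, hg.comp_perm] at hfg
    exact mul_left_cancel₀ (by exact_mod_cast (Equiv.Perm.sign (Tuple.sort v)).ne_zero) hfg
  · rw [hf.eq_zero_of_not_injective hv, hg.eq_zero_of_not_injective hv]

theorem sum {κ : Type*} (s : Finset κ) {F : κ → (Fin (n + 1) → ι) → ℝ}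
    (hF : ∀ p, IsAlternatingArray (F p)) :
    IsAlternatingArray fun v => ∑ p ∈ s, F p v := fun v i => by
  simp only [hF _ v i, Finset.sum_neg_distrib]

end IsAlternatingArray

theorem g2psi_swap₁₂ (i j k l : Fin 7) : g2psi j i k l = -g2psi i j k l := by
  simp only [g2psi, E4, E3]; ring

theorem g2psi_swap₂₃ (i j k l : Fin 7) : g2psi i k j l = -g2psi i j k l := by
  simp only [g2psi, E4, E3]; ring

theorem g2psi_swap₃₄ (i j k l : Fin 7) : g2psi i j l k = -g2psi i j k l := by
  simp only [g2psi, E4, E3]; ring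

theorem vec5_eta (v : Fin 5 → Fin 7) : ![v 0, v 1, v 2, v 3, v 4] = v := by
  funext k; fin_cases k <;> rfl

theorem isAlternatingArray_wedge32 (α : Fin 7 → Fin 7 → Fin 7 → ℝ) (β : Fin 7 → Fin 7 → ℝ) :
    IsAlternatingArray fun v : Fin 5 → Fin 7 =>
      wedge32 α β (v 0) (v 1) (v 2) (v 3) (v 4) := by
  intro v i
  simp only [wedge32, vec5_eta]
  rw [← mul_neg, ← Finset.sum_neg_distrib]
  congr 1
  refine Fintype.sum_equiv (Equiv.mulLeft (Equiv.swap i.castSucc i.succ)) _ _ fun σ => ?_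
  simp [Equiv.Perm.sign_swap (Fin.castSucc_lt_succ (i := i)).ne]

theorem sum_perm_fin_succ {M : Type*} [AddCommMonoid M] (n : ℕ)
    (f : Equiv.Perm (Fin (n + 1)) → M) :
    ∑ σ, f σ = ∑ p, ∑ τ, f (Equiv.Perm.decomposeFin.symm (p, τ)) := by
  rw [← Equiv.Perm.decomposeFin.symm.sum_comp, Fintype.sum_prod_type]

set_option maxHeartbeats 1000000 in
/-- The wedge product of alternating arrays as a sum over shuffles. -/
theorem wedge32_eq_sum_shuffles {α : Fin 7 → Fin 7 → Fin 7 → ℝ} {β : Fin 7 → Fin 7 → ℝ}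
    (h₁₂ : ∀ i j k, α j i k = -α i j k) (h₂₃ : ∀ i j k, α i k j = -α i j k)
    (hβ : ∀ i j, β j i = -β i j) (a b c d e : Fin 7) :
    wedge32 α β a b c d e =
      α a b c * β d e - α a b d * β c e + α a b e * β c d + α a c d * β b e
        - α a c e * β b d + α a d e * β b c - α b c d * β a e + α b c e * β a d
        - α b d e * β a c + α c d e * β a b := by
  unfold wedge32
  simp only [sum_perm_fin_succ, Fin.sum_univ_succ, Finset.univ_unique, Finset.sum_singleton]
  have e1 : (1 : Fin 5) = Fin.succ 0 := rfl
  have e2 : (2 : Fin 5) = Fin.succ (Fin.succ 0) := rfl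
  have e3 : (3 : Fin 5) = Fin.succ (Fin.succ (Fin.succ 0)) := rfl
  have e4 : (4 : Fin 5) = Fin.succ (Fin.succ (Fin.succ (Fin.succ 0))) := rfl
  simp only [Equiv.Perm.decomposeFin_symm_apply_zero, Equiv.Perm.decomposeFin_symm_apply_succ,
    e1, e2, e3, e4, Equiv.Perm.decomposeFin.symm_sign]
  simp [Equiv.swap_apply_def, Subsingleton.elim (default : Equiv.Perm (Fin 1)) 1,
    Subsingleton.elim (default : Fin 1) 0, -Fin.succ_zero_eq_one, -Fin.succ_zero_eq_one',
    -Fin.succ_one_eq_two]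
  simp only [h₁₂ a b, h₁₂ a c, h₁₂ a d, h₁₂ a e, h₁₂ b c, h₁₂ b d, h₁₂ b e, h₁₂ c d, h₁₂ c e,
    h₁₂ d e, h₂₃ _ a c, h₂₃ _ a d, h₂₃ _ a e, h₂₃ _ b c, h₂₃ _ b d, h₂₃ _ b e, h₂₃ _ c d,
    h₂₃ _ c e, h₂₃ _ d e, hβ a b, hβ a c, hβ a d, hβ a e, hβ b c, hβ b d, hβ b e, hβ c d,
    hβ c e, hβ d e]
  simp only [Nat.factorial]
  push_cast
  ring

/-- Integer-valued version of `E3`. -/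
def intE3 (a b c i j k : Fin 7) : ℤ :=
  (if a = i then if b = j then if c = k then 1 else 0 else 0 else 0)
    + (if a = j then if b = k then if c = i then 1 else 0 else 0 else 0)
    + (if a = k then if b = i then if c = j then 1 else 0 else 0 else 0)
    - (if a = i then if b = k then if c = j then 1 else 0 else 0 else 0)
    - (if a = j then if b = i then if c = k then 1 else 0 else 0 else 0)
    - (if a = k then if b = j then if c = i then 1 else 0 else 0 else 0)

/-- Integer-valued version of `E4`. -/
def intE4 (a b c d i j k l : Fin 7) : ℤ :=
  (if a = i then intE3 b c d j k l else 0) - (if a = j then intE3 b c d i k l else 0)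
    + (if a = k then intE3 b c d i j l else 0) - (if a = l then intE3 b c d i j k else 0)

/-- Integer-valued version of `g2psi`. -/
def intPsi (i j k l : Fin 7) : ℤ :=
  intE4 0 1 3 6 i j k l + intE4 0 1 4 5 i j k l + intE4 0 2 3 5 i j k l
    - intE4 0 2 4 6 i j k l - intE4 1 2 3 4 i j k l - intE4 1 2 5 6 i j k l
    - intE4 3 4 5 6 i j k l

theorem intCast_intE3 (a b c i j k : Fin 7) : (intE3 a b c i j k : ℝ) = E3 a b c i j k := by
  simp only [intE3, E3, kd]
  push_cast
  simp only [ite_mul, one_mul, zero_mul]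

theorem intCast_intE4 (a b c d i j k l : Fin 7) :
    (intE4 a b c d i j k l : ℝ) = E4 a b c d i j k l := by
  simp only [intE4, E4, kd]
  push_cast
  simp only [intCast_intE3, ite_mul, one_mul, zero_mul]

theorem intCast_intPsi (i j k l : Fin 7) : (intPsi i j k l : ℝ) = g2psi i j k l := by
  simp only [intPsi, g2psi]
  push_cast
  simp only [intCast_intE4]

theorem intPsi_identity : ∀ i1 i2 : Fin 7, i1 < i2 → ∀ i3, i2 < i3 → ∀ i4, i3 < i4 →
    ∀ i5, i4 < i5 → ∀ m : Fin 7,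
    ∑ p : Fin 7, (intPsi p i1 i2 i3 * intPsi m p i4 i5 - intPsi p i1 i2 i4 * intPsi m p i3 i5
        + intPsi p i1 i2 i5 * intPsi m p i3 i4 + intPsi p i1 i3 i4 * intPsi m p i2 i5
        - intPsi p i1 i3 i5 * intPsi m p i2 i4 + intPsi p i1 i4 i5 * intPsi m p i2 i3
        - intPsi p i2 i3 i4 * intPsi m p i1 i5 + intPsi p i2 i3 i5 * intPsi m p i1 i4
        - intPsi p i2 i4 i5 * intPsi m p i1 i3 + intPsi p i3 i4 i5 * intPsi m p i1 i2) =
      4 * ((if m = i1 then intPsi i2 i3 i4 i5 else 0) - (if m = i2 then intPsi i1 i3 i4 i5 else 0)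
        + (if m = i3 then intPsi i1 i2 i4 i5 else 0) - (if m = i4 then intPsi i1 i2 i3 i5 else 0)
        + (if m = i5 then intPsi i1 i2 i3 i4 else 0)) := by
  decide +kernel

/-- The 5-form `e_m♭ ∧ ψ` is alternating. -/
theorem isAlternatingArray_kd_wedge_g2psi (m : Fin 7) :
    IsAlternatingArray fun v : Fin 5 → Fin 7 =>
      4 * (kd m (v 0) * g2psi (v 1) (v 2) (v 3) (v 4) - kd m (v 1) * g2psi (v 0) (v 2) (v 3) (v 4)
        + kd m (v 2) * g2psi (v 0) (v 1) (v 3) (v 4) - kd m (v 3) * g2psi (v 0) (v 1) (v 2) (v 4)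
        + kd m (v 4) * g2psi (v 0) (v 1) (v 2) (v 3)) := by
  intro v i
  fin_cases i <;>
    simp only [Function.comp_apply, Equiv.swap_apply_def, Fin.zero_eta, Fin.mk_one, Fin.reduceFinMk,
      Fin.reduceCastSucc, Fin.reduceSucc, Fin.reduceEq, if_true, if_false,
      Fin.castSucc_zero, Fin.castSucc_one, Fin.succ_zero_eq_one, Fin.succ_one_eq_two, Fin.isValue] <;>
    simp only [g2psi_swap₁₂ (v 0) (v 1), g2psi_swap₁₂ (v 1) (v 2), g2psi_swap₂₃ _ (v 1) (v 2),
      g2psi_swap₂₃ _ (v 2) (v 3), g2psi_swap₃₄ _ _ (v 2) (v 3), g2psi_swap₃₄ _ _ (v 3) (v 4)] <;>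
    ring

/-- Proposition 2.6, fourth identity:
`Σ_p (e_p ⌟ ψ) ∧ (e_p ⌟ e_m ⌟ ψ) = 4 e_m♭ ∧ ψ  (= 4 ⋆(e_m ⌟ φ))`, in components. -/
theorem stmt_16 (m i1 i2 i3 i4 i5 : Fin 7) :
    ∑ p : Fin 7,
        wedge32 (fun a b c => g2psi p a b c) (fun a b => g2psi m p a b) i1 i2 i3 i4 i5 =
      4 * (kd m i1 * g2psi i2 i3 i4 i5 - kd m i2 * g2psi i1 i3 i4 i5
        + kd m i3 * g2psi i1 i2 i4 i5 - kd m i4 * g2psi i1 i2 i3 i5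
        + kd m i5 * g2psi i1 i2 i3 i4) := by
  have h := IsAlternatingArray.ext_strictMono
    (IsAlternatingArray.sum Finset.univ fun p => isAlternatingArray_wedge32
      (fun a b c => g2psi p a b c) (fun a b => g2psi m p a b))
    (isAlternatingArray_kd_wedge_g2psi m) fun v hv => ?_
  · exact congrFun h ![i1, i2, i3, i4, i5]
  · have hlt : ∀ i : Fin 4, v i.castSucc < v i.succ := fun i => hv Fin.castSucc_lt_succ
    have key := intPsi_identity (v 0) (v 1) (hlt 0) (v 2) (hlt 1) (v 3) (hlt 2) (v 4) (hlt 3) m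
    have key' := congrArg (Int.cast : ℤ → ℝ) key
    push_cast at key'
    simp only [intCast_intPsi] at key'
    simp only [kd, ite_mul, one_mul, zero_mul]
    rw [← key']
    refine Finset.sum_congr rfl fun p _ => ?_
    rw [wedge32_eq_sum_shuffles (fun i j k => g2psi_swap₂₃ p i j k)
      (fun i j k => g2psi_swap₃₄ p i j k) (fun i j => g2psi_swap₃₄ m p i j)]
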